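/- arXiv:2401.13610 — 2 statements merged into one kernel-verified Lean document; each statement's English description precedes it below -/
import Mathlib

section
/- Let S be a finite set, c : S → ℂ a template, x : S → ℂ, and S_1, …, S_m ⊆ S subsets with S_1 ∪ … ∪ S_m = S. Assume that for each j ∈ {1, …, m} there exist α_j ∈ ℂ, α_j ≠ 0, and β_j ∈ ℂ with x_i = α_j·c_i + β_j for all i ∈ S_j. Define a simple graph on {1, …, m} with an edge between j and k if and only if there exist i₁, i₂ ∈ S_j ∩ S_k with i₁ ≠ i₂ and c_{i₁} ≠ c_{i₂}. If this graph is connected, then there exist α ∈ ℂ, α ≠ 0, and β ∈ ℂ such that x_i = α·c_i + β for all i ∈ S; i.e., the whole point set forms the desired shape. -/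
/-- An affine map of a field is determined by its values at two distinct points. -/
theorem affine_coeff_unique {K : Type*} [Field K] {a b a' b' u v : K} (huv : u ≠ v)
    (hu : a * u + b = a' * u + b') (hv : a * v + b = a' * v + b') : a = a' ∧ b = b' := by
  have ha : a = a' := mul_right_cancel₀ (sub_ne_zero.mpr huv) (by linear_combination hu - hv)
  subst ha
  exact ⟨rfl, add_left_cancel hu⟩

/-- A function that agrees at adjacent vertices is constant on a preconnected graph. -/
theorem SimpleGraph.Preconnected.eq_of_forall_adj {V X : Type*} {G : SimpleGraph V}
    (hG : G.Preconnected) {f : V → X} (hf : ∀ v w, G.Adj v w → f v = f w) (v w : V) :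
    f v = f w := by
  obtain ⟨p⟩ := hG v w
  induction p with
  | nil => rfl
  | cons h _ ih => exact (hf _ _ h).trans ih

/-- gluing direction of Lemma 1: if each subset `S j` forms its
desired sub-shape under some direct similarity, and the overlap graph (edges
require two shared robots with distinct template positions) is connected, then
the whole point set forms the desired shape under one direct similarity. -/
theorem subshapes_glue_to_global_shape
    {ι : Type*} [Fintype ι] [DecidableEq ι] (c x : ι → ℂ)
    (m : ℕ) (S : Fin m → Finset ι)
    (hcover : ∀ i : ι, ∃ j, i ∈ S j)
    (hshape : ∀ j, ∃ α β : ℂ, α ≠ 0 ∧ ∀ i ∈ S j, x i = α * c i + β)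
    (hconn : (SimpleGraph.fromRel (fun j k =>
      ∃ i₁ ∈ S j ∩ S k, ∃ i₂ ∈ S j ∩ S k, i₁ ≠ i₂ ∧ c i₁ ≠ c i₂)).Connected) :
    ∃ α β : ℂ, α ≠ 0 ∧ ∀ i, x i = α * c i + β := by
  choose α β hα hx using hshape
  have hadj : ∀ j k, (SimpleGraph.fromRel (fun j k =>
      ∃ i₁ ∈ S j ∩ S k, ∃ i₂ ∈ S j ∩ S k, i₁ ≠ i₂ ∧ c i₁ ≠ c i₂)).Adj j k →
      (α j, β j) = (α k, β k) := by
    have key : ∀ j k, (∃ i₁ ∈ S j ∩ S k, ∃ i₂ ∈ S j ∩ S k, i₁ ≠ i₂ ∧ c i₁ ≠ c i₂) →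
        (α j, β j) = (α k, β k) := by
      rintro j k ⟨i₁, h₁, i₂, h₂, -, hc⟩
      rw [Finset.mem_inter] at h₁ h₂
      exact Prod.ext_iff.mpr (affine_coeff_unique hc
        ((hx j i₁ h₁.1).symm.trans (hx k i₁ h₁.2)) ((hx j i₂ h₂.1).symm.trans (hx k i₂ h₂.2)))
    intro j k h
    rw [SimpleGraph.fromRel_adj] at h
    exact h.2.elim (key j k) fun h' => (key k j h').symm
  obtain ⟨j₀⟩ := hconn.nonempty
  refine ⟨α j₀, β j₀, hα j₀, fun i => ?_⟩
  obtain ⟨j, hj⟩ := hcover i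
  obtain ⟨h₁, h₂⟩ := Prod.ext_iff.mp (hconn.preconnected.eq_of_forall_adj hadj j₀ j)
  dsimp only at h₁ h₂
  rw [h₁, h₂]
  exact hx j i hj
end

section
/- Let J be a finite set of cameras carrying a simple graph G that is a tree (connected and acyclic), let ι be a finite set of robots, let c : ι → ℂ be a template, and let S : J → Finset ι with ⋃_{j∈J} S_j = ι. Assume: (i) for every edge {j, k} of G, the set S_j ∩ S_k has exactly two elements i₁ ≠ i₂, and c_{i₁} ≠ c_{i₂}; (ii) for every pair of distinct j, k not adjacent in G, S_j ∩ S_k = ∅. For each j ∈ J let ρ^j : ι → ℂ satisfy: ρ^j_i = 0 for i ∉ S_j, Σ_{i ∈ S_j} ρ^j_i = 0, and Σ_{i ∈ S_j} conj(c_i) · ρ^j_i = 0. If for every robot i ∈ ι the equilibrium condition Σ_{j : i ∈ S_j} ρ^j_i = 0 holds, then ρ^j_i = 0 for every j ∈ J and i ∈ ι. -/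
open Finset

/-- A finite nonempty acyclic graph has a vertex with at most one neighbor. -/
theorem SimpleGraph.IsAcyclic.exists_forall_adj_eq {V : Type*} [Finite V] [Nonempty V]
    {G : SimpleGraph V} (hG : G.IsAcyclic) : ∃ u w, ∀ x, G.Adj u x → x = w := by
  obtain ⟨u, v, p, hp, hmax⟩ := SimpleGraph.Walk.exists_isPath_forall_isPath_length_le_length G
  refine ⟨u, p.snd, fun x hx => hG.eq_snd_of_adj_start hp hx ?_⟩
  by_contra hxp
  have := hmax _ _ _ (hp.cons (h := hx.symm) hxp)
  simp at this

/-- A residual supported on two points with distinct template values vanishes as soon as it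
satisfies the centroid and normal-equation conditions. -/
theorem eq_zero_of_centroid_of_normal {a b x y : ℂ} (hab : a ≠ b) (hsum : x + y = 0)
    (hnormal : (starRingEnd ℂ) a * x + (starRingEnd ℂ) b * y = 0) : x = 0 ∧ y = 0 := by
  have hab' : (starRingEnd ℂ) a - (starRingEnd ℂ) b ≠ 0 :=
    sub_ne_zero.2 fun h => hab ((starRingEnd ℂ).injective h)
  have hx : x = 0 := by
    refine (mul_eq_zero.1 ?_).resolve_left hab'
    linear_combination hnormal - (starRingEnd ℂ) b * hsum
  exact ⟨hx, by simpa [hx] using hsum⟩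

/-- global equilibrium, Theorem 1: under the topological
conditions TC3–TC5 (the camera graph is a tree, adjacent cameras share exactly
two robots with distinct template points, non-adjacent cameras share none),
if each camera's residuals satisfy the support, centroid and normal-equation
conditions and every robot's summed motion vector vanishes, then all residuals
vanish. -/
theorem equilibrium_only_at_desired_shape
    {J ι : Type*} [Fintype J] [Fintype ι] [DecidableEq ι]
    (G : SimpleGraph J) (hG : G.IsTree)
    (c : ι → ℂ) (S : J → Finset ι)
    (hcover : ∀ i : ι, ∃ j, i ∈ S j)
    (hedge : ∀ j k, G.Adj j k →
      ∃ i₁ i₂ : ι, i₁ ≠ i₂ ∧ c i₁ ≠ c i₂ ∧ S j ∩ S k = {i₁, i₂})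
    (hnonedge : ∀ j k, j ≠ k → ¬ G.Adj j k → S j ∩ S k = ∅)
    (ρ : J → ι → ℂ)
    (hsupp : ∀ j, ∀ i, i ∉ S j → ρ j i = 0)
    (hcentroid : ∀ j, ∑ i ∈ S j, ρ j i = 0)
    (hnormal : ∀ j, ∑ i ∈ S j, (starRingEnd ℂ) (c i) * ρ j i = 0)
    (hequil : ∀ i, ∑ j ∈ Finset.univ.filter (fun j => i ∈ S j), ρ j i = 0) :
    ∀ j, ∀ i, ρ j i = 0 := by
  classical
  by_contra! hne
  obtain ⟨j₀, hj₀⟩ := hne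
  have : Nonempty {j | ∃ i, ρ j i ≠ 0} := ⟨⟨j₀, hj₀⟩⟩
  obtain ⟨⟨j, i₀, hi₀⟩, ⟨k, _⟩, huniq⟩ :=
    (hG.isAcyclic.induce {j | ∃ i, ρ j i ≠ 0}).exists_forall_adj_eq
  have hmem : ∀ l i, ρ l i ≠ 0 → i ∈ S l := fun l i h => by
    by_contra hi
    exact h (hsupp l i hi)
  have key : ∀ i, ρ j i ≠ 0 → G.Adj j k ∧ i ∈ S j ∩ S k := by
    intro i hi
    obtain ⟨l, hlj, hl⟩ : ∃ l, l ≠ j ∧ ρ l i ≠ 0 := by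
      by_contra! h
      refine hi ?_
      rw [← hequil i, Finset.sum_eq_single j (fun l _ hl => h l hl)]
      intro hj
      exact hsupp j i (by simpa using hj)
    have hil : i ∈ S j ∩ S l := Finset.mem_inter.2 ⟨hmem j i hi, hmem l i hl⟩
    have hadj : G.Adj j l := by
      by_contra h
      simp [hnonedge j l hlj.symm h] at hil
    obtain rfl : l = k := congrArg Subtype.val (huniq ⟨l, i, hl⟩ hadj)
    exact ⟨hadj, hil⟩
  obtain ⟨i₁, i₂, hi, hc, hS⟩ := hedge j k (key i₀ hi₀).1
  have hsub : {i₁, i₂} ⊆ S j := hS ▸ Finset.inter_subset_left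
  have hzero : ∀ i, i ∉ ({i₁, i₂} : Finset ι) → ρ j i = 0 := fun i h => by
    by_contra h'
    exact h (hS ▸ (key i h').2)
  have h₁ := hcentroid j
  have h₂ := hnormal j
  rw [← Finset.sum_subset hsub fun i _ h => hzero i h, Finset.sum_pair hi] at h₁
  rw [← Finset.sum_subset hsub fun i _ h => by rw [hzero i h, mul_zero],
    Finset.sum_pair hi] at h₂
  obtain ⟨hz₁, hz₂⟩ := eq_zero_of_centroid_of_normal hc h₁ h₂
  have hmem₀ := (key i₀ hi₀).2
  rw [hS, Finset.mem_insert, Finset.mem_singleton] at hmem₀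
  rcases hmem₀ with rfl | rfl
  exacts [hi₀ hz₁, hi₀ hz₂]
end
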